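/- arXiv:1310.3409 — 3 statements merged into one kernel-verified Lean document; each statement's English description precedes it below -/
import Mathlib

section
/- Every polymatroidal ideal is of strong intersection type; that is, if I ⊂ K[x_1,...,x_n] is the monomial ideal generated by the monomials x^u with u ranging over the bases of a discrete polymatroid, then I = ∩_{p ∈ Ass(S/I)} p^{reg(I(p))}. -/
open MvPolynomial

noncomputable section

variable (K : Type) [Field K]

/-- The monomial prime ideal `p_F` generated by the variables `x_i`, `i ∈ F`. -/
def monomialPrimeIdeal {n : ℕ} (F : Finset (Fin n)) : Ideal (MvPolynomial (Fin n) K) :=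
  Ideal.span ((fun i => (X i : MvPolynomial (Fin n) K)) '' F)

/-- A monomial ideal: an ideal generated by monomials. -/
def IsMonomialIdeal {σ : Type*} (I : Ideal (MvPolynomial σ K)) : Prop :=
  ∃ A : Set (σ →₀ ℕ), I = Ideal.span ((fun u => (monomial u (1 : K))) '' A)

/-- The graded maximal ideal of a polynomial ring. -/
def maxIdeal (σ : Type*) : Ideal (MvPolynomial σ K) :=
  Ideal.span (Set.range (X : σ → MvPolynomial σ K))

/-- The monomial localization map `S → S(p_F)`, sending `x_i ↦ x_i` for `i ∈ F`
and `x_i ↦ 1` otherwise. -/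
def monomialLocalizationMap {n : ℕ} (F : Finset (Fin n)) :
    MvPolynomial (Fin n) K →+* MvPolynomial {i : Fin n // i ∈ F} K :=
  (aeval (fun i : Fin n =>
    if h : i ∈ F then (X ⟨i, h⟩ : MvPolynomial {i : Fin n // i ∈ F} K) else 1)).toRingHom

/-- The monomial localization `I(p_F) ⊆ S(p_F)` of a monomial ideal `I`. -/
def mLoc {n : ℕ} (I : Ideal (MvPolynomial (Fin n) K)) (F : Finset (Fin n)) :
    Ideal (MvPolynomial {i : Fin n // i ∈ F} K) :=
  I.map (monomialLocalizationMap K F)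

/-- `min(J)`: the minimal degree of a nonzero homogeneous element of `J`, which for a
graded ideal is the minimal degree of a generator. -/
def minGenDeg {σ : Type*} (J : Ideal (MvPolynomial σ K)) : ℕ :=
  sInf {d : ℕ | ∃ f ∈ J, f ≠ 0 ∧ MvPolynomial.IsHomogeneous f d}

/-- `max(Soc(S/J))`: the maximal degree of a nonzero homogeneous element of the
socle `(J : m)/J` of `S/J`. -/
def maxSocleDeg {σ : Type*} (J : Ideal (MvPolynomial σ K)) : ℕ :=
  sSup {d : ℕ | ∃ f : MvPolynomial σ K, f ∉ J ∧ MvPolynomial.IsHomogeneous f d ∧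
    ∀ i : σ, X i * f ∈ J}

/-- `I` is of intersection type: `I` is an intersection of (positive) powers of
monomial prime ideals. -/
def IsIntersectionType {n : ℕ} (I : Ideal (MvPolynomial (Fin n) K)) : Prop :=
  ∃ (r : ℕ) (F : Fin r → Finset (Fin n)) (d : Fin r → ℕ),
    (∀ i, 0 < d i) ∧ I = ⨅ i, (monomialPrimeIdeal K (F i)) ^ (d i)

/-- A finite graded free resolution of an ideal `I ⊆ S = K[x_i : i ∈ σ]`:
`⋯ → F_1 → F_0 → I → 0`, where `F_i` is a finite graded free module with basis `ι i`
whose basis element `b` sits in degree `deg i b`, the maps are graded of degree `0`,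
and the complex is exact with the augmentation `F_0 → S` having image `I`. -/
structure GradedFreeResolution (σ : Type) [Fintype σ] (I : Ideal (MvPolynomial σ K)) where
  ι : ℕ → Type
  finite : ∀ i, Finite (ι i)
  deg : ∀ i, ι i → ℕ
  aug : (ι 0 →₀ MvPolynomial σ K) →ₗ[MvPolynomial σ K] MvPolynomial σ K
  d : ∀ i, (ι (i + 1) →₀ MvPolynomial σ K) →ₗ[MvPolynomial σ K] (ι i →₀ MvPolynomial σ K)
  aug_range : ∀ f : MvPolynomial σ K, f ∈ LinearMap.range aug ↔ f ∈ I
  exact_zero : LinearMap.range (d 0) = LinearMap.ker aug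
  exact : ∀ i, LinearMap.range (d (i + 1)) = LinearMap.ker (d i)
  aug_homog : ∀ b : ι 0, MvPolynomial.IsHomogeneous (aug (Finsupp.single b 1)) (deg 0 b)
  d_homog : ∀ (i : ℕ) (b : ι (i + 1)) (a : ι i),
    (d i (Finsupp.single b 1)) a = 0 ∨
      ∃ m, deg (i + 1) b = deg i a + m ∧
        MvPolynomial.IsHomogeneous ((d i (Finsupp.single b 1)) a) m

/-- The Castelnuovo–Mumford regularity of an ideal `I` of a polynomial ring: the least
`r` such that `I` admits a (finite) graded free resolution whose `i`-th free module is
generated in degrees `≤ r + i`; for a finitely generated graded ideal this is the value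
computed from the minimal graded free resolution. -/
def reg {σ : Type} [Fintype σ] (I : Ideal (MvPolynomial σ K)) : ℕ :=
  sInf {r : ℕ | ∃ R : GradedFreeResolution K σ I, ∀ (i : ℕ) (b : R.ι i), R.deg i b ≤ r + i}

/-- `I` is generated in the single degree `t`. -/
def GeneratedInSingleDegree {σ : Type} (I : Ideal (MvPolynomial σ K)) (t : ℕ) : Prop :=
  ∃ A : Set (MvPolynomial σ K), (∀ f ∈ A, MvPolynomial.IsHomogeneous f t) ∧ I = Ideal.span A

/-- `I` has a linear resolution: it is generated in a single degree `t` and its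
Castelnuovo–Mumford regularity equals `t`. -/
def HasLinearResolution {σ : Type} [Fintype σ] (I : Ideal (MvPolynomial σ K)) : Prop :=
  ∃ t : ℕ, GeneratedInSingleDegree K I t ∧ reg K I = t

/-- A discrete polymatroid on the ground set `[n]`: a nonempty finite set of integer
vectors in `ℤ_{≥0}^n` closed under componentwise minimization and satisfying the
exchange property. -/
structure DiscretePolymatroid (n : ℕ) where
  carrier : Finset (Fin n →₀ ℕ)
  nonempty : carrier.Nonempty
  lower : ∀ u ∈ carrier, ∀ v : Fin n →₀ ℕ, v ≤ u → v ∈ carrier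
  exchange : ∀ u ∈ carrier, ∀ v ∈ carrier, (∑ i, u i) < (∑ i, v i) →
    ∃ i : Fin n, u i < v i ∧ u + Finsupp.single i 1 ∈ carrier

namespace DiscretePolymatroid

variable {n : ℕ} (P : DiscretePolymatroid n)

/-- The rank of `P`: the maximal modulus `|u| = ∑ i, u i` of an element of `P`. -/
def rank : ℕ := P.carrier.sup fun u => ∑ i, u i

/-- The set of bases of `P`: the elements of maximal modulus. -/
def bases : Finset (Fin n →₀ ℕ) := P.carrier.filter fun u => (∑ i, u i) = P.rank

/-- The polymatroidal ideal associated with `P`: the ideal generated by the monomials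
`x^u`, `u` a basis of `P`. -/
def toIdeal (K : Type) [Field K] : Ideal (MvPolynomial (Fin n) K) :=
  Ideal.span ((fun u => (monomial u (1 : K))) '' (P.bases : Set (Fin n →₀ ℕ)))

/-- The ground set rank function `ρ` of `P`: `ρ(F) = max {u(F) : u ∈ B(P)}`. -/
def rkFun (F : Finset (Fin n)) : ℕ := P.bases.sup fun u => ∑ i ∈ F, u i

/-- The complementary rank function `τ(F) = d - ρ([n] \ F)`. -/
def crkFun (F : Finset (Fin n)) : ℕ := P.rank - P.rkFun Fᶜ

end DiscretePolymatroid

lemma exists_add_single_eq_of_sum_eq {ι : Type*} [Fintype ι] {y z : ι →₀ ℕ} (h : y ≤ z)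
    (hs : ∑ i, z i = ∑ i, y i + 1) : ∃ c, y + Finsupp.single c 1 = z := by
  classical
  obtain ⟨c, hc⟩ : ∃ c, y c < z c := by
    by_contra! hcon
    have := Finset.sum_le_sum fun i (_ : i ∈ Finset.univ) => hcon i
    omega
  refine ⟨c, ?_⟩
  have hle : ∀ i ∈ Finset.univ, (y + Finsupp.single c 1 : ι →₀ ℕ) i ≤ z i := by
    intro i _
    by_cases hi : c = i
    · subst hi; simpa using hc
    · simpa [Finsupp.single_apply, hi] using h i
  have hsum : ∑ i, (y + Finsupp.single c 1 : ι →₀ ℕ) i = ∑ i, z i := by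
    simp [Finset.sum_add_distrib, Finsupp.single_apply, hs]
  ext i
  exact (Finset.sum_eq_sum_iff_of_le hle).1 hsum i (Finset.mem_univ i)

namespace DiscretePolymatroid

variable {n : ℕ} (P : DiscretePolymatroid n)

lemma mem_bases {u : Fin n →₀ ℕ} : u ∈ P.bases ↔ u ∈ P.carrier ∧ ∑ i, u i = P.rank := by
  simp [bases]

lemma sum_le_rank {u : Fin n →₀ ℕ} (hu : u ∈ P.carrier) : ∑ i, u i ≤ P.rank :=
  Finset.le_sup (f := fun u : Fin n →₀ ℕ => ∑ i, u i) hu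

lemma bases_nonempty : P.bases.Nonempty := by
  obtain ⟨u, hu, h⟩ := Finset.exists_mem_eq_sup P.carrier P.nonempty
    (fun u : Fin n →₀ ℕ => ∑ i, u i)
  exact ⟨u, P.mem_bases.2 ⟨hu, h.symm⟩⟩

/-- Any vector of `P` can be enlarged, using only coordinates of `u`, to modulus at least `|u|`. -/
lemma exists_augmentation {x u : Fin n →₀ ℕ} (hx : x ∈ P.carrier) (hu : u ∈ P.carrier) :
    ∃ y ∈ P.carrier, x ≤ y ∧ (∀ i, y i ≤ max (x i) (u i)) ∧ ∑ i, u i ≤ ∑ i, y i := by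
  induction hk : ∑ i, u i - ∑ i, x i generalizing x with
  | zero => exact ⟨x, hx, le_rfl, fun i => le_max_left _ _, by omega⟩
  | succ k ih =>
    obtain ⟨i, hi, hmem⟩ := P.exchange x hx u hu (by omega)
    obtain ⟨y, hy, hxy, hyu, hs⟩ := ih hmem
      (by simp [Finset.sum_add_distrib, Finsupp.single_apply]; omega)
    refine ⟨y, hy, le_trans (by simp) hxy, fun j => (hyu j).trans ?_, hs⟩
    by_cases hj : i = j
    · subst hj; simp; omega
    · simp [hj]

lemma exists_base_augmentation {x u : Fin n →₀ ℕ} (hx : x ∈ P.carrier) (hu : u ∈ P.bases) :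
    ∃ y ∈ P.bases, x ≤ y ∧ ∀ i, y i ≤ max (x i) (u i) := by
  rw [mem_bases] at hu
  obtain ⟨y, hy, hxy, hyu, hs⟩ := P.exists_augmentation hx hu.1
  exact ⟨y, P.mem_bases.2 ⟨hy, le_antisymm (P.sum_le_rank hy) (hu.2 ▸ hs)⟩, hxy, hyu⟩

/-- The exchange property of bases in which the coordinate to be increased is prescribed. -/
lemma base_exchange {u v : Fin n →₀ ℕ} (hu : u ∈ P.bases) (hv : v ∈ P.bases) {i : Fin n}
    (hi : u i < v i) :
    ∃ c, v c < u c ∧ ∃ w ∈ P.bases, w + Finsupp.single c 1 = u + Finsupp.single i 1 := by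
  have hx : u ⊓ v + Finsupp.single i 1 ∈ P.carrier := by
    refine P.lower v (P.mem_bases.1 hv).1 _ fun j => ?_
    by_cases hj : i = j
    · subst hj; simp; omega
    · simp [hj]
  obtain ⟨y, hy, hxy, hyu⟩ := P.exists_base_augmentation hx hu
  have hle : y ≤ u + Finsupp.single i 1 := fun j => (hyu j).trans (by simp)
  obtain ⟨c, hc⟩ := exists_add_single_eq_of_sum_eq hle (by
    simp [Finset.sum_add_distrib, Finsupp.single_apply, (P.mem_bases.1 hu).2,
      (P.mem_bases.1 hy).2])
  have hyi := hxy i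
  have hyc := hxy c
  have hci := DFunLike.congr_fun hc i
  have hcc := DFunLike.congr_fun hc c
  refine ⟨c, ?_, y, hy, hc⟩
  by_cases hj : i = c
  · subst hj; simp at *; omega
  · simp [Finsupp.single_apply, hj, Ne.symm hj] at *; omega

/-- A vector dominates a base as soon as on every coordinate subset its modulus is at least that
of some base. -/
lemma exists_base_le {w : Fin n →₀ ℕ}
    (h : ∀ G : Finset (Fin n), ∃ b ∈ P.bases, ∑ i ∈ G, b i ≤ ∑ i ∈ G, w i) :
    ∃ u ∈ P.bases, u ≤ w := by
  classical
  have hne : (P.carrier.filter (· ≤ w)).Nonempty := by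
    obtain ⟨u, hu⟩ := P.nonempty
    exact ⟨0, Finset.mem_filter.2 ⟨P.lower u hu 0 fun i => Nat.zero_le _, fun i => Nat.zero_le _⟩⟩
  obtain ⟨u, hu, hmax⟩ := Finset.exists_max_image _ (fun u : Fin n →₀ ℕ => ∑ i, u i) hne
  rw [Finset.mem_filter] at hu
  refine ⟨u, P.mem_bases.2 ⟨hu.1, ?_⟩, hu.2⟩
  by_contra hrank
  have hlt := lt_of_le_of_ne (P.sum_le_rank hu.1) hrank
  set T := Finset.univ.filter fun i => u + Finsupp.single i 1 ∉ P.carrier with hT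
  have hsat : ∀ i ∈ Tᶜ, w i ≤ u i := by
    intro i hi
    have hi' : u + Finsupp.single i 1 ∈ P.carrier := by simpa [hT] using hi
    by_contra! hlt'
    have := hmax _ (Finset.mem_filter.2 ⟨hi', fun j => by
      by_cases hj : i = j
      · subst hj; simpa using hlt'
      · simpa [Finsupp.single_apply, hj] using hu.2 j⟩)
    simp [Finset.sum_add_distrib, Finsupp.single_apply] at this
  obtain ⟨b, hb, hbw⟩ := h Tᶜ
  rw [mem_bases] at hb
  have hbT : ∑ i ∈ T, u i < ∑ i ∈ T, b i := by
    have h1 := Finset.sum_add_sum_compl T u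
    have h2 := Finset.sum_add_sum_compl T b
    have h3 := Finset.sum_le_sum hsat
    omega
  have hfil : ∀ v : Fin n →₀ ℕ, ∑ i, v.filter (· ∈ T) i = ∑ i ∈ T, v i := by
    intro v
    simp [Finsupp.filter_apply]
  have hfle : ∀ v : Fin n →₀ ℕ, v.filter (· ∈ T) ≤ v := by
    intro v i
    rw [Finsupp.filter_apply]
    split_ifs <;> simp
  obtain ⟨i, hi, hx⟩ := P.exchange _ (P.lower u hu.1 _ (hfle u)) _ (P.lower b hb.1 _ (hfle b))
    (by rwa [hfil, hfil])
  have hiT : i ∈ T := by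
    by_contra hiT
    simp [hiT] at hi
  have huiT : u + Finsupp.single i 1 ∉ P.carrier := by simpa [hT] using hiT
  obtain ⟨y, hy, hxy, hyu, hs⟩ := P.exists_augmentation hx hu.1
  have hle : y ≤ u + Finsupp.single i 1 := fun j => (hyu j).trans (by
    have := hfle u j
    simp only [Finsupp.add_apply]
    omega)
  have hsum : ∑ j, (u + Finsupp.single i 1 : Fin n →₀ ℕ) j = ∑ j, u j + 1 := by
    simp [Finset.sum_add_distrib, Finsupp.single_apply]
  have hys : ∑ j, y j = ∑ j, u j := by
    refine le_antisymm (not_lt.1 fun hcon => huiT ?_) hs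
    have : y = u + Finsupp.single i 1 := by
      ext j
      exact (Finset.sum_eq_sum_iff_of_le fun j _ => hle j).1
        (le_antisymm (Finset.sum_le_sum fun j _ => hle j) (by omega)) j (Finset.mem_univ j)
    exact this ▸ hy
  obtain ⟨c, hc⟩ := exists_add_single_eq_of_sum_eq hle (by omega)
  have hyi := hxy i
  have hyc := hxy c
  have hcc := DFunLike.congr_fun hc c
  have hci : i ≠ c := by
    rintro rfl
    simp [hiT] at hyi hcc
    omega
  have hcT : c ∉ T := by
    intro hcT
    simp [hcT, hci] at hyc hcc
    omega
  have huc : u + Finsupp.single c 1 ∈ P.carrier := by simpa [hT] using hcT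
  obtain ⟨k, hk, hyk⟩ := P.exchange y hy _ huc (by
    simp [Finset.sum_add_distrib, Finsupp.single_apply, hys])
  have hkc : c = k := by
    by_contra hkc
    have hck := DFunLike.congr_fun hc k
    simp [Finsupp.single_apply, hkc] at hk hck
    omega
  exact huiT (by rwa [← hc, hkc])

/-- The least modulus on `F` of a base of `P`. -/
def minDegreeOn (F : Finset (Fin n)) : ℕ :=
  sInf ((fun u : Fin n →₀ ℕ => ∑ i ∈ F, u i) '' (P.bases : Set (Fin n →₀ ℕ)))

lemma minDegreeOn_le (F : Finset (Fin n)) {u : Fin n →₀ ℕ} (hu : u ∈ P.bases) :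
    P.minDegreeOn F ≤ ∑ i ∈ F, u i :=
  Nat.sInf_le ⟨u, hu, rfl⟩

lemma exists_base_sum_eq_minDegreeOn (F : Finset (Fin n)) :
    ∃ u ∈ P.bases, ∑ i ∈ F, u i = P.minDegreeOn F := by
  obtain ⟨u, hu⟩ := P.bases_nonempty
  exact Nat.sInf_mem ⟨_, Set.mem_image_of_mem (fun u : Fin n →₀ ℕ => ∑ i ∈ F, u i) hu⟩

/-- A base of least modulus on `F` can be modified on `F` to lie below any other base on `F`. -/
lemma exists_base_glue (F : Finset (Fin n)) {u v : Fin n →₀ ℕ} (hu : u ∈ P.bases)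
    (huF : ∑ i ∈ F, u i = P.minDegreeOn F) (hv : v ∈ P.bases) :
    ∃ w ∈ P.bases, (∀ i ∉ F, w i = u i) ∧ (∀ i ∈ F, w i ≤ v i) ∧
      ∑ i ∈ F, w i = P.minDegreeOn F := by
  classical
  have hx : u.filter (· ∉ F) ∈ P.carrier := by
    refine P.lower u (P.mem_bases.1 hu).1 _ fun i => ?_
    rw [Finsupp.filter_apply]
    split_ifs <;> simp
  obtain ⟨w, hw, hxw, hwv⟩ := P.exists_base_augmentation hx hv
  have hle : ∀ i ∈ Fᶜ, u i ≤ w i := by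
    intro i hi
    simpa [Finset.mem_compl.1 hi] using hxw i
  have h1 := Finset.sum_add_sum_compl F u
  have h2 := Finset.sum_add_sum_compl F w
  have h3 := Finset.sum_le_sum hle
  have h4 := P.minDegreeOn_le F hw
  have h5 := (P.mem_bases.1 hu).2
  have h6 := (P.mem_bases.1 hw).2
  refine ⟨w, hw, fun i hi => ?_, fun i hi => ?_, by omega⟩
  · exact ((Finset.sum_eq_sum_iff_of_le hle).1 (by omega) i (Finset.mem_compl.2 hi)).symm
  · simpa [hi] using hwv i

/-- The restrictions to `F` of the bases of `P` of least modulus on `F`. -/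
def localBases (F : Finset (Fin n)) : Finset ({i : Fin n // i ∈ F} →₀ ℕ) := by
  classical
  exact (P.bases.filter fun u => ∑ i ∈ F, u i = P.minDegreeOn F).image
    (Finsupp.subtypeDomain (· ∈ F))

lemma mem_localBases {F : Finset (Fin n)} {w : {i : Fin n // i ∈ F} →₀ ℕ} :
    w ∈ P.localBases F ↔ ∃ u ∈ P.bases, ∑ i ∈ F, u i = P.minDegreeOn F ∧
      u.subtypeDomain (· ∈ F) = w := by
  simp [localBases, and_assoc]

lemma localBases_nonempty (F : Finset (Fin n)) : (P.localBases F).Nonempty := by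
  obtain ⟨u, hu, huF⟩ := P.exists_base_sum_eq_minDegreeOn F
  exact ⟨_, P.mem_localBases.2 ⟨u, hu, huF, rfl⟩⟩

lemma sum_localBases {F : Finset (Fin n)} {w : {i : Fin n // i ∈ F} →₀ ℕ}
    (hw : w ∈ P.localBases F) : ∑ i, w i = P.minDegreeOn F := by
  obtain ⟨u, hu, huF, rfl⟩ := P.mem_localBases.1 hw
  rw [← huF]
  exact Finset.sum_coe_sort F u

lemma localBases_exchange {F : Finset (Fin n)} {u v : {i : Fin n // i ∈ F} →₀ ℕ}
    (hu : u ∈ P.localBases F) (hv : v ∈ P.localBases F) {i : {i : Fin n // i ∈ F}}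
    (hi : u i < v i) :
    ∃ c, v c < u c ∧ ∃ w ∈ P.localBases F,
      w + Finsupp.single c 1 = u + Finsupp.single i 1 := by
  obtain ⟨u, hub, huF, rfl⟩ := P.mem_localBases.1 hu
  obtain ⟨v, hvb, hvF, rfl⟩ := P.mem_localBases.1 hv
  obtain ⟨v', hv', hv'u, hv'v, hv'F⟩ := P.exists_base_glue F hub huF hvb
  have hEq : ∀ j ∈ F, v' j = v j :=
    (Finset.sum_eq_sum_iff_of_le hv'v).1 (hv'F.trans hvF.symm)
  simp only [Finsupp.subtypeDomain_apply] at hi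
  rw [← hEq i i.2] at hi
  obtain ⟨c, hc, w, hw, hwc⟩ := P.base_exchange hub hv' hi
  have hcF : c ∈ F := by
    by_contra hcF
    rw [hv'u c hcF] at hc
    exact lt_irrefl _ hc
  refine ⟨⟨c, hcF⟩, by simpa [hEq c hcF] using hc, w.subtypeDomain (· ∈ F),
    P.mem_localBases.2 ⟨w, hw, ?_, rfl⟩, ?_⟩
  · have := congrArg (fun z : Fin n →₀ ℕ => ∑ j ∈ F, z j) hwc
    simp [Finset.sum_add_distrib, Finsupp.single_apply, hcF] at this
    omega
  · ext j
    have := DFunLike.congr_fun hwc j.1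
    simpa only [Finsupp.subtypeDomain_apply, Finsupp.add_apply, Finsupp.single_apply,
      Subtype.ext_iff] using this

lemma exists_localBases_le (F : Finset (Fin n)) {v : Fin n →₀ ℕ} (hv : v ∈ P.bases) :
    ∃ w ∈ P.localBases F, w ≤ v.subtypeDomain (· ∈ F) := by
  obtain ⟨u, hu, huF⟩ := P.exists_base_sum_eq_minDegreeOn F
  obtain ⟨w, hw, -, hwv, hwF⟩ := P.exists_base_glue F hu huF hv
  exact ⟨_, P.mem_localBases.2 ⟨w, hw, hwF, rfl⟩, fun i => hwv i i.2⟩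

end DiscretePolymatroid

lemma homogeneousComponent_add_mul_of_isHomogeneous {σ R : Type*} [CommSemiring R] {k t : ℕ}
    (f : MvPolynomial σ R) {g : MvPolynomial σ R} (hg : g.IsHomogeneous t) :
    homogeneousComponent (k + t) (f * g) = homogeneousComponent k f * g := by
  let := gradedAlgebra (σ := σ) (R := R)
  have h := DirectSum.coe_decompose_mul_add_of_right_mem (homogeneousSubmodule σ R) (i := k)
    (a := f) (b := g) (j := t) hg
  exact (decomposition.decompose'_apply _ _).symm.trans
    (h.trans (congrArg (· * g) (decomposition.decompose'_apply _ _)))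

variable {K}

lemma exists_homogeneous_linearCombination_eq {σ ι κ : Type*}
    {m : ι → κ →₀ MvPolynomial σ K} {t : ℕ} (hm : ∀ i a, (m i a).IsHomogeneous t) {s : Set ι}
    {v : κ →₀ MvPolynomial σ K} (hv : ∀ a, (v a).IsHomogeneous (1 + t))
    (hvs : v ∈ Submodule.span (MvPolynomial σ K) (m '' s)) :
    ∃ c : ι →₀ MvPolynomial σ K, (∀ j ∉ s, c j = 0) ∧ (∀ j, (c j).IsHomogeneous 1) ∧
      Finsupp.linearCombination (MvPolynomial σ K) m c = v := by
  obtain ⟨l, hl, rfl⟩ := (Finsupp.mem_span_image_iff_linearCombination _).1 hvs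
  refine ⟨l.mapRange (homogeneousComponent 1) (map_zero _), fun j hj => ?_, fun j => ?_, ?_⟩
  · have : l j = 0 := by
      by_contra hne
      exact hj (hl (Finsupp.mem_support_iff.2 hne))
    simp [this]
  · simpa using homogeneousComponent_isHomogeneous 1 (l j)
  · ext1 a
    rw [← homogeneousComponent_eq_self (hv a), Finsupp.linearCombination_apply,
      Finsupp.linearCombination_apply, Finsupp.sum_mapRange_index (by simp)]
    simp only [Finsupp.sum, Finsupp.finsetSum_apply, Finsupp.smul_apply, smul_eq_mul, map_sum]
    exact Finset.sum_congr rfl fun i _ =>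
      (homogeneousComponent_add_mul_of_isHomogeneous _ (hm i a)).symm

lemma mem_span_X_of_mul_X_mem {σ : Type*} {T : Set σ} {a : σ} (ha : a ∉ T)
    {f : MvPolynomial σ K} (h : f * X a ∈ Ideal.span (X '' T : Set (MvPolynomial σ K))) :
    f ∈ Ideal.span (X '' T : Set (MvPolynomial σ K)) := by
  classical
  rw [mem_ideal_span_X_image] at h ⊢
  intro m hm
  obtain ⟨i, hi, hne⟩ := h (m + Finsupp.single a 1) (by simpa using hm)
  refine ⟨i, hi, ?_⟩
  have : a ≠ i := fun hai => ha (hai ▸ hi)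
  simpa [this] using hne

variable (K)

/-- A finite linearly ordered family of elements of a free module, homogeneous of the same degree,
whose successive colon ideals are generated by variables. -/
structure LinearQuotients (σ : Type) where
  κ : Type
  ι : Type
  finite : Finite ι
  linearOrder : LinearOrder ι
  degree : ℕ
  gen : ι → κ →₀ MvPolynomial σ K
  vars : ι → Set σ
  gen_homog : ∀ i a, (gen i a).IsHomogeneous degree
  smul_gen_mem_iff : ∀ i f, f • gen i ∈ Submodule.span (MvPolynomial σ K) (gen '' Set.Iio i) ↔
    f ∈ Ideal.span (X '' vars i : Set (MvPolynomial σ K))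

namespace LinearQuotients

variable {K} {σ : Type} (L : LinearQuotients K σ)

attribute [instance] finite linearOrder

lemma exists_relation (i : L.ι) {a : σ} (ha : a ∈ L.vars i) :
    ∃ c : L.ι →₀ MvPolynomial σ K, (∀ j ∉ Set.Iio i, c j = 0) ∧ (∀ j, (c j).IsHomogeneous 1) ∧
      Finsupp.linearCombination (MvPolynomial σ K) L.gen c =
        (X a : MvPolynomial σ K) • L.gen i :=
  exists_homogeneous_linearCombination_eq L.gen_homog
    (fun b => (isHomogeneous_X K a).mul (L.gen_homog i b))
    ((L.smul_gen_mem_iff i _).2 (Ideal.subset_span ⟨a, ha, rfl⟩))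

/-- The coefficients expressing `X a • gen i` through the earlier generators. -/
def relation (p : Σₗ i, L.vars i) : L.ι →₀ MvPolynomial σ K :=
  (L.exists_relation p.1 p.2.2).choose

/-- The linear syzygy of the generators attached to a generator and a variable of its colon
ideal. -/
def syzygy (p : Σₗ i, L.vars i) : L.ι →₀ MvPolynomial σ K :=
  Finsupp.single p.1 (X p.2.1) - L.relation p

lemma relation_apply_of_le {p : Σₗ i, L.vars i} {j : L.ι} (h : p.1 ≤ j) : L.relation p j = 0 :=
  (L.exists_relation p.1 p.2.2).choose_spec.1 j (not_lt.2 h)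

lemma relation_homog (p : Σₗ i, L.vars i) (j : L.ι) : (L.relation p j).IsHomogeneous 1 :=
  (L.exists_relation p.1 p.2.2).choose_spec.2.1 j

lemma linearCombination_relation (p : Σₗ i, L.vars i) :
    Finsupp.linearCombination (MvPolynomial σ K) L.gen (L.relation p) =
      (X p.2.1 : MvPolynomial σ K) • L.gen p.1 :=
  (L.exists_relation p.1 p.2.2).choose_spec.2.2

lemma syzygy_apply_self (p : Σₗ i, L.vars i) : L.syzygy p p.1 = X p.2.1 := by
  simp [syzygy, L.relation_apply_of_le le_rfl]

lemma syzygy_apply_of_lt {p : Σₗ i, L.vars i} {j : L.ι} (h : p.1 < j) : L.syzygy p j = 0 := by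
  simp [syzygy, L.relation_apply_of_le h.le, h.ne]

lemma syzygy_homog (p : Σₗ i, L.vars i) (j : L.ι) : (L.syzygy p j).IsHomogeneous 1 := by
  classical
  rw [syzygy, Finsupp.sub_apply, Finsupp.single_apply]
  refine IsHomogeneous.sub ?_ (L.relation_homog p j)
  split_ifs
  · exact isHomogeneous_X K _
  · exact isHomogeneous_zero _ _ _

lemma syzygy_mem_ker (p : Σₗ i, L.vars i) :
    L.syzygy p ∈ LinearMap.ker (Finsupp.linearCombination (MvPolynomial σ K) L.gen) := by
  rw [LinearMap.mem_ker, syzygy, map_sub, linearCombination_relation]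
  simp

lemma mem_span_syzygy_Iio {i : L.ι}
    (h : ∀ i' < i, ∀ g ∈ LinearMap.ker (Finsupp.linearCombination (MvPolynomial σ K) L.gen),
      (∀ j, i' < j → g j = 0) →
        g ∈ Submodule.span (MvPolynomial σ K) (L.syzygy '' {p | p.1 ≤ i'}))
    {g : L.ι →₀ MvPolynomial σ K}
    (hg : g ∈ LinearMap.ker (Finsupp.linearCombination (MvPolynomial σ K) L.gen))
    (hgi : ∀ j, i ≤ j → g j = 0) :
    g ∈ Submodule.span (MvPolynomial σ K) (L.syzygy '' {p | p.1 < i}) := by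
  by_cases h0 : g = 0
  · simp [h0]
  have hne := Finsupp.support_nonempty_iff.2 h0
  have hmem := g.support.max'_mem hne
  have hlt : g.support.max' hne < i := by
    by_contra hcon
    exact Finsupp.mem_support_iff.1 hmem (hgi _ (not_lt.1 hcon))
  refine Submodule.span_mono (Set.image_mono fun p hp => lt_of_le_of_lt hp hlt)
    (h _ hlt g hg fun j hj => ?_)
  by_contra hcon
  exact absurd (g.support.le_max' j (Finsupp.mem_support_iff.2 hcon)) (not_le.2 hj)

lemma apply_mem_span_vars {i : L.ι} {g : L.ι →₀ MvPolynomial σ K}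
    (hg : g ∈ LinearMap.ker (Finsupp.linearCombination (MvPolynomial σ K) L.gen))
    (hgi : ∀ j, i < j → g j = 0) : g i ∈ Ideal.span (X '' L.vars i : Set (MvPolynomial σ K)) := by
  rw [← L.smul_gen_mem_iff]
  have hsplit : g = Finsupp.single i (g i) + g.erase i := (Finsupp.single_add_erase i g).symm
  rw [LinearMap.mem_ker, hsplit, map_add, Finsupp.linearCombination_single] at hg
  rw [eq_neg_of_add_eq_zero_left hg]
  refine neg_mem ((Finsupp.mem_span_image_iff_linearCombination _).2 ⟨_, ?_, rfl⟩)
  intro j hj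
  rw [SetLike.mem_coe, Finsupp.support_erase, Finset.mem_erase, Finsupp.mem_support_iff] at hj
  refine lt_of_le_of_ne (not_lt.1 fun hcon => hj.2 (hgi j hcon)) hj.1

lemma mem_span_syzygy_Iic (i : L.ι) :
    ∀ g ∈ LinearMap.ker (Finsupp.linearCombination (MvPolynomial σ K) L.gen),
      (∀ j, i < j → g j = 0) →
        g ∈ Submodule.span (MvPolynomial σ K) (L.syzygy '' {p | p.1 ≤ i}) := by
  induction i using WellFoundedLT.induction with
  | ind i ih =>
  intro g hg hgi
  have hspan : ∀ f ∈ Ideal.span (X '' L.vars i : Set (MvPolynomial σ K)),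
      ∃ s ∈ Submodule.span (MvPolynomial σ K) (L.syzygy '' {p | p.1 ≤ i}),
        s ∈ LinearMap.ker (Finsupp.linearCombination (MvPolynomial σ K) L.gen) ∧
          s i = f ∧ ∀ j, i < j → s j = 0 := by
    intro f hf
    induction hf using Submodule.span_induction with
    | mem f hf =>
      obtain ⟨a, ha, rfl⟩ := hf
      let p : Σₗ i, L.vars i := ⟨i, a, ha⟩
      exact ⟨L.syzygy p, Submodule.subset_span ⟨p, le_refl i, rfl⟩, L.syzygy_mem_ker p,
        L.syzygy_apply_self p, fun j hj => L.syzygy_apply_of_lt (p := p) hj⟩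
    | zero => exact ⟨0, zero_mem _, zero_mem _, rfl, fun _ _ => rfl⟩
    | add f f' _ _ h h' =>
      obtain ⟨s, h1, h2, h3, h4⟩ := h
      obtain ⟨s', h1', h2', h3', h4'⟩ := h'
      exact ⟨s + s', add_mem h1 h1', add_mem h2 h2', by simp [h3, h3'],
        fun j hj => by simp [h4 j hj, h4' j hj]⟩
    | smul c f _ h =>
      obtain ⟨s, h1, h2, h3, h4⟩ := h
      exact ⟨c • s, Submodule.smul_mem _ _ h1, Submodule.smul_mem _ _ h2, by simp [h3],
        fun j hj => by simp [h4 j hj]⟩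
  obtain ⟨s, h1, h2, h3, h4⟩ := hspan _ (L.apply_mem_span_vars hg hgi)
  have hsub := L.mem_span_syzygy_Iio ih (sub_mem hg h2) fun j hj => by
    rcases hj.eq_or_lt with rfl | hj
    · simp [h3]
    · simp [hgi j hj, h4 j hj]
  rw [← sub_add_cancel g s]
  exact add_mem (Submodule.span_mono (Set.image_mono fun p hp => le_of_lt hp) hsub) h1

lemma range_linearCombination_syzygy :
    LinearMap.range (Finsupp.linearCombination (MvPolynomial σ K) L.syzygy) =
      LinearMap.ker (Finsupp.linearCombination (MvPolynomial σ K) L.gen) := by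
  rw [Finsupp.range_linearCombination]
  refine le_antisymm (Submodule.span_le.2 ?_) fun g hg => ?_
  · rintro _ ⟨p, rfl⟩
    exact L.syzygy_mem_ker p
  · by_cases h0 : g = 0
    · simp [h0]
    have hne := Finsupp.support_nonempty_iff.2 h0
    refine Submodule.span_mono (Set.image_subset_range _ _)
      (L.mem_span_syzygy_Iic (g.support.max' hne) g hg fun j hj => ?_)
    by_contra hcon
    exact absurd (g.support.le_max' j (Finsupp.mem_support_iff.2 hcon)) (not_le.2 hj)

lemma smul_syzygy_mem_iff [LinearOrder σ] (p : Σₗ i, L.vars i) (f : MvPolynomial σ K) :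
    f • L.syzygy p ∈ Submodule.span (MvPolynomial σ K) (L.syzygy '' Set.Iio p) ↔
      f ∈ Ideal.span (X '' {b : σ | b ∈ L.vars p.1 ∧ b < p.2.1} : Set (MvPolynomial σ K)) := by
  constructor
  · intro h
    refine mem_span_X_of_mul_X_mem (a := p.2.1) (fun hcon => lt_irrefl _ hcon.2) ?_
    have hle : Submodule.span (MvPolynomial σ K) (L.syzygy '' Set.Iio p) ≤
        Submodule.comap (Finsupp.lapply p.1)
          (Ideal.span (X '' {b | b ∈ L.vars p.1 ∧ b < p.2.1} : Set (MvPolynomial σ K))) := by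
      rw [Submodule.span_le]
      rintro _ ⟨q, hq, rfl⟩
      rcases Sigma.Lex.lt_def.1 hq with hlt | ⟨heq, hlt⟩
      · simp [L.syzygy_apply_of_lt hlt]
      · obtain ⟨j, b⟩ := q
        obtain ⟨i, a⟩ := p
        obtain rfl : j = i := heq
        refine Ideal.subset_span ⟨b, ⟨b.2, hlt⟩, ?_⟩
        exact (L.syzygy_apply_self ⟨j, b⟩).symm
    simpa [L.syzygy_apply_self] using hle h
  · intro h
    induction h using Submodule.span_induction with
    | mem f hf =>
      obtain ⟨b, ⟨hb, hlt⟩, rfl⟩ := hf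
      obtain ⟨i, a⟩ := p
      let q : Σₗ i, L.vars i := ⟨i, b, hb⟩
      let p : Σₗ i, L.vars i := ⟨i, a⟩
      have hqp : q < p := Sigma.Lex.lt_def.2 (Or.inr ⟨rfl, hlt⟩)
      have hsub := L.mem_span_syzygy_Iio (i := i) (fun i' _ => L.mem_span_syzygy_Iic i')
        (g := (X b : MvPolynomial σ K) • L.syzygy p - (X a.1 : MvPolynomial σ K) • L.syzygy q)
        (sub_mem (Submodule.smul_mem _ _ (L.syzygy_mem_ker p))
          (Submodule.smul_mem _ _ (L.syzygy_mem_ker q))) fun j hj => by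
        rcases hj.eq_or_lt with rfl | hj
        · have h1 : L.syzygy p i = X a.1 := L.syzygy_apply_self p
          have h2 : L.syzygy q i = X b := L.syzygy_apply_self q
          simp [h1, h2, mul_comm]
        · have h1 : L.syzygy p j = 0 := L.syzygy_apply_of_lt (p := p) hj
          have h2 : L.syzygy q j = 0 := L.syzygy_apply_of_lt (p := q) hj
          simp [h1, h2]
      rw [← sub_add_cancel ((X b : MvPolynomial σ K) • L.syzygy p)
        ((X a.1 : MvPolynomial σ K) • L.syzygy q)]
      refine add_mem (Submodule.span_mono (Set.image_mono fun r hr => ?_) hsub)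
        (Submodule.smul_mem _ _ (Submodule.subset_span ⟨q, hqp, rfl⟩))
      exact Sigma.Lex.lt_def.2 (Or.inl hr)
    | zero => simp
    | add f f' _ _ h h' => rw [add_smul]; exact add_mem h h'
    | smul c f _ h => rw [smul_assoc]; exact Submodule.smul_mem _ _ h

/-- The linear syzygies of a family with linear quotients have linear quotients themselves. -/
def next [Finite σ] [LinearOrder σ] : LinearQuotients K σ where
  κ := L.ι
  ι := Σₗ i, L.vars i
  finite := inferInstanceAs (Finite (Σ i, L.vars i))
  linearOrder := inferInstance
  degree := 1
  gen := L.syzygy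
  vars p := {b | b ∈ L.vars p.1 ∧ b < p.2.1}
  gen_homog := L.syzygy_homog
  smul_gen_mem_iff := L.smul_syzygy_mem_iff

/-- The iterated linear syzygies. -/
def iterate [Finite σ] [LinearOrder σ] (L : LinearQuotients K σ) : ℕ → LinearQuotients K σ
  | 0 => L
  | k + 1 => (iterate L k).next

end LinearQuotients

lemma mul_monomial_mem_span_iff {σ R : Type*} [CommSemiring R] {A : Set (σ →₀ ℕ)}
    {f : MvPolynomial σ R} {s : σ →₀ ℕ} :
    f * monomial s 1 ∈ Ideal.span ((fun u => monomial u (1 : R)) '' A) ↔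
      ∀ a ∈ f.support, ∃ u ∈ A, u ≤ a + s := by
  rw [mem_ideal_span_monomial_image]
  constructor
  · intro h a ha
    exact h (a + s) (by simpa using ha)
  · intro h b hb
    rw [mem_support_iff, coeff_mul_monomial', mul_one] at hb
    split_ifs at hb with hs
    · obtain ⟨u, hu, hle⟩ := h (b - s) (mem_support_iff.2 hb)
      exact ⟨u, hu, by rwa [tsub_add_cancel_of_le hs] at hle⟩
    · exact absurd rfl hb

namespace LinearQuotients

variable {K} {σ : Type} (L : LinearQuotients K σ)

lemma mem_range_comp_linearCombination_gen
    (φ : (L.κ →₀ MvPolynomial σ K) →ₗ[MvPolynomial σ K] MvPolynomial σ K)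
    (f : MvPolynomial σ K) :
    f ∈ LinearMap.range (φ ∘ₗ Finsupp.linearCombination (MvPolynomial σ K) L.gen) ↔
      f ∈ Ideal.span (Set.range fun i => φ (L.gen i)) := by
  rw [LinearMap.range_comp, Finsupp.range_linearCombination, Submodule.map_span,
    ← Set.range_comp]
  rfl

lemma linearCombination_syzygy_single_homog (p : Σₗ i, L.vars i) (j : L.ι) :
    (Finsupp.linearCombination (MvPolynomial σ K) L.syzygy
      (Finsupp.single p 1) j).IsHomogeneous 1 := by
  simpa using L.syzygy_homog p j

/-- The linear graded free resolution of an ideal generated by a family with linear quotients. -/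
def resolution [Fintype σ] [LinearOrder σ]
    (φ : (L.κ →₀ MvPolynomial σ K) →ₗ[MvPolynomial σ K] MvPolynomial σ K)
    (hφ : Function.Injective φ) (hhom : ∀ i, (φ (L.gen i)).IsHomogeneous L.degree)
    {I : Ideal (MvPolynomial σ K)} (hI : I = Ideal.span (Set.range fun i => φ (L.gen i))) :
    GradedFreeResolution K σ I where
  ι k := (L.iterate k).ι
  finite k := (L.iterate k).finite
  deg k _ := L.degree + k
  aug := φ ∘ₗ Finsupp.linearCombination (MvPolynomial σ K) L.gen
  d k := Finsupp.linearCombination (MvPolynomial σ K) (L.iterate k).syzygy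
  aug_range f := by
    rw [hI]
    exact L.mem_range_comp_linearCombination_gen φ f
  exact_zero := by
    rw [LinearMap.ker_comp_of_ker_eq_bot _ (LinearMap.ker_eq_bot.2 hφ)]
    exact L.range_linearCombination_syzygy
  exact k := (L.iterate k).next.range_linearCombination_syzygy
  aug_homog b := by
    have h (b : L.ι) : (φ (Finsupp.linearCombination (MvPolynomial σ K) L.gen
        (Finsupp.single b 1))).IsHomogeneous L.degree := by
      simpa using hhom b
    exact h b
  d_homog k b a := by
    refine Or.inr ⟨1, rfl, ?_⟩
    exact (L.iterate k).linearCombination_syzygy_single_homog b a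

/-- Monomials of the same degree whose exponents satisfy the exchange property of bases have
linear quotients with respect to the decreasing lexicographic order. -/
def ofExchange (K : Type) [Field K] {σ : Type} [Finite σ] [LinearOrder σ] (B : Finset (σ →₀ ℕ))
    (t : ℕ) (hdeg : ∀ u ∈ B, u.degree = t)
    (hex : ∀ u ∈ B, ∀ v ∈ B, ∀ i, u i < v i → ∃ c, v c < u c ∧
      ∃ w ∈ B, w + Finsupp.single c 1 = u + Finsupp.single i 1) : LinearQuotients K σ where
  κ := Unit
  ι := {x : (Lex (σ →₀ ℕ))ᵒᵈ // ofLex (OrderDual.ofDual x) ∈ B}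
  finite := inferInstanceAs (Finite B)
  linearOrder := inferInstance
  degree := t
  gen u := Finsupp.single () (monomial (ofLex (OrderDual.ofDual u.1)) 1)
  vars u := {i | ∃ v ∈ B, OrderDual.ofDual u.1 < toLex v ∧
    v ≤ ofLex (OrderDual.ofDual u.1) + Finsupp.single i 1}
  gen_homog u a := by
    simpa using isHomogeneous_monomial 1 (hdeg _ u.2)
  smul_gen_mem_iff u f := by
    obtain ⟨u, hu⟩ := u
    obtain ⟨u, rfl⟩ : ∃ v, OrderDual.toDual (toLex v) = u := ⟨_, rfl⟩
    change u ∈ B at hu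
    have key : f • Finsupp.single () (monomial u (1 : K)) ∈
        Submodule.span (MvPolynomial σ K)
          ((fun v : {x : (Lex (σ →₀ ℕ))ᵒᵈ // ofLex (OrderDual.ofDual x) ∈ B} =>
            Finsupp.single () (monomial (ofLex (OrderDual.ofDual v.1)) (1 : K))) ''
              Set.Iio ⟨OrderDual.toDual (toLex u), hu⟩) ↔
        f * monomial u 1 ∈ Ideal.span ((fun v => monomial v (1 : K)) ''
          {v | v ∈ B ∧ toLex u < toLex v}) := by
      have hset : (fun v : {x : (Lex (σ →₀ ℕ))ᵒᵈ // ofLex (OrderDual.ofDual x) ∈ B} =>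
            Finsupp.single () (monomial (ofLex (OrderDual.ofDual v.1)) (1 : K))) ''
              Set.Iio ⟨OrderDual.toDual (toLex u), hu⟩ =
          Finsupp.lsingle (R := MvPolynomial σ K) () '' ((fun v => monomial v (1 : K)) ''
            {v | v ∈ B ∧ toLex u < toLex v}) := by
        ext x
        constructor
        · rintro ⟨v, hv, rfl⟩
          exact ⟨_, ⟨ofLex (OrderDual.ofDual v.1), ⟨v.2, hv⟩, rfl⟩, rfl⟩
        · rintro ⟨_, ⟨v, ⟨hvB, hv⟩, rfl⟩, rfl⟩
          exact ⟨⟨OrderDual.toDual (toLex v), hvB⟩, hv, rfl⟩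
      rw [hset, ← Submodule.map_span, Finsupp.smul_single, smul_eq_mul]
      exact (Finsupp.single_injective ()).mem_set_image
    refine key.trans ?_
    rw [mul_monomial_mem_span_iff, mem_ideal_span_X_image]
    constructor
    · intro h a ha
      obtain ⟨v, ⟨hvB, huv⟩, hv⟩ := h a ha
      obtain ⟨i, hi, hlt⟩ := Finsupp.Lex.lt_iff.1 huv
      simp only [ofLex_toLex] at hi hlt
      obtain ⟨c, hc, w, hw, hwc⟩ := hex _ hu _ hvB i hlt
      have hle : w ≤ u + Finsupp.single i 1 := hwc ▸ le_self_add
      refine ⟨i, ⟨w, hw, ?_, hle⟩, ?_⟩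
      · have hic : i < c := by
          rcases lt_trichotomy c i with h | h | h
          · exact absurd (hi c h) (Nat.ne_of_gt hc)
          · subst h; omega
          · exact h
        refine Finsupp.Lex.lt_iff.2 ⟨i, fun j hj => ?_, ?_⟩
        · simpa [hj.ne', (hj.trans hic).ne'] using (DFunLike.congr_fun hwc j).symm
        · have := DFunLike.congr_fun hwc i
          simp [hic.ne'] at this
          change u i < w i
          omega
      · have := hv i
        simp only [Finsupp.add_apply] at this
        omega
    · intro h a ha
      obtain ⟨i, ⟨v, hvB, huv, hv⟩, hne⟩ := h a ha
      refine ⟨v, ⟨hvB, huv⟩, hv.trans ?_⟩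
      rw [add_comm a]
      exact add_le_add_right (Finsupp.single_le_iff.2 (Nat.one_le_iff_ne_zero.2 hne)) _

end LinearQuotients

/-- Ideals generated by monomials of degree `t` whose exponents satisfy the exchange property of
bases have regularity `t`. -/
lemma reg_span_monomial_of_exchange {σ : Type} [Fintype σ] [LinearOrder σ] {B : Finset (σ →₀ ℕ)}
    (hne : B.Nonempty) {t : ℕ} (hdeg : ∀ u ∈ B, u.degree = t)
    (hex : ∀ u ∈ B, ∀ v ∈ B, ∀ i, u i < v i → ∃ c, v c < u c ∧
      ∃ w ∈ B, w + Finsupp.single c 1 = u + Finsupp.single i 1) :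
    reg K (Ideal.span ((fun u => monomial u (1 : K)) '' (B : Set (σ →₀ ℕ)))) = t := by
  let L := LinearQuotients.ofExchange K B t hdeg hex
  let R := L.resolution (Finsupp.lapply ())
    (I := Ideal.span ((fun u => monomial u (1 : K)) '' (B : Set (σ →₀ ℕ))))
    (fun x y h => Finsupp.ext fun _ => h) (fun i => L.gen_homog i ()) (by
      congr 1
      ext x
      constructor
      · rintro ⟨v, hv, rfl⟩
        exact ⟨⟨OrderDual.toDual (toLex v), hv⟩, Finsupp.single_eq_same⟩
      · rintro ⟨v, rfl⟩
        exact ⟨_, v.2, Finsupp.single_eq_same.symm⟩)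
  refine le_antisymm (Nat.sInf_le ⟨R, fun i b => le_rfl⟩) (le_csInf ⟨t, R, fun i b => le_rfl⟩ ?_)
  rintro r ⟨Q, hQ⟩
  by_contra! hlt
  have haug : Q.aug = 0 := by
    ext b a
    have hmem : Q.aug (Finsupp.single b 1) ∈
        Ideal.span ((fun u => monomial u (1 : K)) '' (B : Set (σ →₀ ℕ))) :=
      (Q.aug_range _).1 ⟨_, rfl⟩
    simp only [LinearMap.comp_apply, Finsupp.lsingle_apply, LinearMap.zero_comp,
      LinearMap.zero_apply, coeff_zero]
    by_contra hne0
    obtain ⟨u, hu, hua⟩ := mem_ideal_span_monomial_image.1 hmem a (mem_support_iff.2 hne0)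
    have h1 : a.degree = Q.deg 0 b := by
      by_contra hcon
      exact hne0 ((Q.aug_homog b).coeff_eq_zero hcon)
    have h2 := hQ 0 b
    have h3 := Finsupp.degree_mono hua
    rw [hdeg u hu] at h3
    omega
  obtain ⟨u, hu⟩ := hne
  have hu0 : (monomial u (1 : K)) ∈ LinearMap.range Q.aug :=
    (Q.aug_range _).2 (Ideal.subset_span ⟨u, hu, rfl⟩)
  rw [haug, LinearMap.range_zero, Submodule.mem_bot, monomial_eq_zero] at hu0
  exact one_ne_zero hu0

lemma monomialLocalizationMap_monomial {n : ℕ} (F : Finset (Fin n)) (u : Fin n →₀ ℕ) :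
    monomialLocalizationMap K F (monomial u 1) = monomial (u.subtypeDomain (· ∈ F)) 1 := by
  change aeval _ _ = _
  rw [aeval_monomial, map_one, one_mul, monomial_eq, C_1, one_mul,
    Finsupp.prod_fintype _ _ (by simp), Finsupp.prod_fintype _ _ (by simp)]
  rw [← Finset.prod_subset (Finset.subset_univ F) (fun i _ hi => by simp [hi]),
    ← Finset.prod_coe_sort]
  exact Finset.prod_congr rfl fun i _ => by simp

namespace DiscretePolymatroid

variable {n : ℕ} (P : DiscretePolymatroid n)

lemma mLoc_toIdeal (F : Finset (Fin n)) :
    mLoc K (P.toIdeal K) F = Ideal.span ((fun u => monomial u (1 : K)) ''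
      (P.localBases F : Set ({i : Fin n // i ∈ F} →₀ ℕ))) := by
  rw [mLoc, toIdeal, Ideal.map_span, Set.image_image]
  simp only [monomialLocalizationMap_monomial]
  refine le_antisymm (Ideal.span_le.2 ?_) (Ideal.span_mono ?_)
  · rintro _ ⟨v, hv, rfl⟩
    obtain ⟨w, hw, hwv⟩ := P.exists_localBases_le F hv
    exact Ideal.mem_of_dvd _ (monomial_dvd_monomial.2 ⟨Or.inr hwv, dvd_rfl⟩)
      (Ideal.subset_span ⟨w, hw, rfl⟩)
  · rintro _ ⟨w, hw, rfl⟩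
    obtain ⟨u, hu, -, rfl⟩ := P.mem_localBases.1 hw
    exact ⟨u, hu, rfl⟩

lemma reg_mLoc_toIdeal (F : Finset (Fin n)) :
    reg K (mLoc K (P.toIdeal K) F) = P.minDegreeOn F := by
  rw [mLoc_toIdeal]
  exact reg_span_monomial_of_exchange K (P.localBases_nonempty F)
    (fun u hu => (Finsupp.degree_eq_sum u).trans (P.sum_localBases hu))
    fun u hu v hv i hi => P.localBases_exchange hu hv hi

end DiscretePolymatroid

section

variable {K} {n : ℕ} {F : Finset (Fin n)}

lemma mem_monomialPrimeIdeal_iff {f : MvPolynomial (Fin n) K} :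
    f ∈ monomialPrimeIdeal K F ↔ ∀ a ∈ f.support, ∃ i ∈ F, a i ≠ 0 := by
  rw [monomialPrimeIdeal]
  exact mem_ideal_span_X_image

lemma le_sum_of_mem_monomialPrimeIdeal_pow {k : ℕ} {f : MvPolynomial (Fin n) K}
    (hf : f ∈ monomialPrimeIdeal K F ^ k) {a : Fin n →₀ ℕ} (ha : a ∈ f.support) :
    k ≤ ∑ i ∈ F, a i := by
  have hle : monomialPrimeIdeal K F ^ k ≤
      Ideal.span ((fun u => monomial u (1 : K)) '' {u | k ≤ ∑ i ∈ F, u i}) := by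
    clear hf
    induction k with
    | zero =>
      refine le_of_le_of_eq le_top ((Ideal.eq_top_iff_one _).2 ?_).symm
      exact Ideal.subset_span ⟨0, by simp, rfl⟩
    | succ k ih =>
      rw [pow_succ]
      refine (Ideal.mul_mono_left ih).trans ?_
      rw [monomialPrimeIdeal, Ideal.span_mul_span', Ideal.span_le]
      rintro _ ⟨_, ⟨u, hu, rfl⟩, _, ⟨i, hi, rfl⟩, rfl⟩
      refine Ideal.subset_span ⟨u + Finsupp.single i 1, ?_, ?_⟩
      · have : i ∈ F := hi
        simpa [Finset.sum_add_distrib, Finsupp.single_apply, this] using hu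
      · simp [X, monomial_mul]
  obtain ⟨u, hu, hua⟩ := mem_ideal_span_monomial_image.1 (hle hf) a ha
  exact le_trans hu (Finset.sum_le_sum fun i _ => hua i)

lemma monomial_mem_monomialPrimeIdeal_pow (u : Fin n →₀ ℕ) :
    monomial u (1 : K) ∈ monomialPrimeIdeal K F ^ ∑ i ∈ F, u i := by
  rw [monomial_eq, C_1, one_mul, Finsupp.prod_fintype _ _ (by simp),
    ← Finset.prod_pow_eq_pow_sum]
  have hX : ∀ i ∈ F, (X i : MvPolynomial (Fin n) K) ∈ monomialPrimeIdeal K F :=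
    fun i hi => Ideal.subset_span ⟨i, hi, rfl⟩
  refine Ideal.mem_of_dvd _ (Finset.prod_dvd_prod_of_subset F _ _ (Finset.subset_univ F))
    (Ideal.prod_mem_prod fun i hi => Ideal.pow_mem_pow (hX i hi) _)

end

lemma isPrime_monomialPrimeIdeal {n : ℕ} (F : Finset (Fin n)) :
    (monomialPrimeIdeal K F).IsPrime := by
  let φ : MvPolynomial (Fin n) K →ₐ[K] MvPolynomial (Fin n) K :=
    aeval fun i => if i ∈ F then 0 else X i
  have hφ (f : MvPolynomial (Fin n) K) :
      Ideal.Quotient.mk (monomialPrimeIdeal K F) (φ f) = Ideal.Quotient.mk _ f := by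
    induction f using MvPolynomial.induction_on with
    | C a => simp [φ]
    | add p q hp hq => simp only [map_add, hp, hq]
    | mul_X p i hp =>
      rw [map_mul, map_mul, map_mul, hp, aeval_X]
      by_cases hi : i ∈ F
      · have hX : (X i : MvPolynomial (Fin n) K) ∈ monomialPrimeIdeal K F :=
          Ideal.subset_span ⟨i, hi, rfl⟩
        rw [if_pos hi, map_zero, Ideal.Quotient.eq_zero_iff_mem.2 hX]
      · rw [if_neg hi]
  have hker : monomialPrimeIdeal K F = RingHom.ker φ := by
    refine le_antisymm (Ideal.span_le.2 ?_) fun f hf => ?_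
    · rintro _ ⟨i, hi, rfl⟩
      simp [φ, Finset.mem_coe.1 hi]
    · rw [← Ideal.Quotient.eq_zero_iff_mem, ← hφ, (RingHom.mem_ker).1 hf, map_zero]
  exact hker ▸ RingHom.ker_isPrime φ

namespace DiscretePolymatroid

variable {n : ℕ} (P : DiscretePolymatroid n)

lemma toIdeal_le_pow_minDegreeOn (F : Finset (Fin n)) :
    P.toIdeal K ≤ monomialPrimeIdeal K F ^ P.minDegreeOn F := by
  rw [toIdeal, Ideal.span_le]
  rintro _ ⟨u, hu, rfl⟩
  exact Ideal.pow_le_pow_right (P.minDegreeOn_le F hu) (monomial_mem_monomialPrimeIdeal_pow u)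

/-- A monomial whose modulus falls short of `P.minDegreeOn F` by one on `F` only, and is large
outside of `F`, has annihilator the prime of `F` modulo the ideal of `P`. -/
lemma monomialPrimeIdeal_mem_associatedPrimes {F : Finset (Fin n)} {w : Fin n →₀ ℕ}
    (hF : ∑ i ∈ F, w i + 1 = P.minDegreeOn F)
    (hsub : ∀ G ⊂ F, P.minDegreeOn G ≤ ∑ i ∈ G, w i) (hout : ∀ i ∉ F, P.rank ≤ w i) :
    monomialPrimeIdeal K F ∈
      associatedPrimes (MvPolynomial (Fin n) K) (MvPolynomial (Fin n) K ⧸ P.toIdeal K) := by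
  have key (a : Fin n →₀ ℕ) : (∃ u ∈ (P.bases : Set (Fin n →₀ ℕ)), u ≤ a + w) ↔
      ∃ i ∈ F, a i ≠ 0 := by
    constructor
    · rintro ⟨u, hu, hle⟩
      by_contra! h0
      have h1 := P.minDegreeOn_le F hu
      have h2 : ∑ i ∈ F, u i ≤ ∑ i ∈ F, w i :=
        Finset.sum_le_sum fun i hi => by simpa [h0 i hi] using hle i
      omega
    · rintro ⟨i, hi, hne⟩
      refine P.exists_base_le fun G => ?_
      obtain ⟨b, hb, hbG⟩ := P.exists_base_sum_eq_minDegreeOn G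
      refine ⟨b, hb, ?_⟩
      simp only [Finsupp.add_apply, Finset.sum_add_distrib]
      by_cases hGF : G ⊆ F
      · rcases hGF.eq_or_ssubset with rfl | hss
        · have := Finset.single_le_sum (f := a) (fun _ _ => Nat.zero_le _) hi
          omega
        · have := hsub G hss
          omega
      · obtain ⟨j, hjG, hjF⟩ := Finset.not_subset.1 hGF
        have h1 := Finset.single_le_sum (f := w) (fun _ _ => Nat.zero_le _) hjG
        have h2 := hout j hjF
        have h3 : ∑ i ∈ G, b i ≤ ∑ i, b i :=
          Finset.sum_le_sum_of_subset (Finset.subset_univ G)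
        have h4 := (P.mem_bases.1 hb).2
        omega
  refine Submodule.isAssociatedPrime_iff.2
    ⟨?_, Ideal.Quotient.mk _ (monomial w 1), Ideal.ext fun f => ?_⟩
  · exact isPrime_monomialPrimeIdeal K F
  · rw [Submodule.mem_colon_singleton, Submodule.mem_bot, ← Ideal.Quotient.mk_eq_mk,
      ← Submodule.Quotient.mk_smul, Submodule.Quotient.mk_eq_zero, smul_eq_mul, toIdeal,
      mul_monomial_mem_span_iff, mem_monomialPrimeIdeal_iff]
    simp only [key]

lemma exists_associatedPrime_sum_lt {w : Fin n →₀ ℕ} (hw : ∀ u ∈ P.bases, ¬ u ≤ w) :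
    ∃ F, monomialPrimeIdeal K F ∈
      associatedPrimes (MvPolynomial (Fin n) K) (MvPolynomial (Fin n) K ⧸ P.toIdeal K) ∧
        ∑ i ∈ F, w i < P.minDegreeOn F := by
  have hex : ∃ G, ∑ i ∈ G, w i < P.minDegreeOn G := by
    by_contra! hcon
    obtain ⟨u, hu, hle⟩ := P.exists_base_le (w := w) fun G => by
      obtain ⟨b, hb, hbG⟩ := P.exists_base_sum_eq_minDegreeOn G
      exact ⟨b, hb, hbG.trans_le (hcon G)⟩
    exact hw u hu hle
  obtain ⟨F, hF, hmin⟩ := wellFounded_lt.has_min {G | ∑ i ∈ G, w i < P.minDegreeOn G} hex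
  change ∑ i ∈ F, w i < P.minDegreeOn F at hF
  obtain ⟨j, hj⟩ : F.Nonempty := by
    by_contra hempty
    obtain rfl := Finset.not_nonempty_iff_eq_empty.1 hempty
    obtain ⟨u, hu⟩ := P.bases_nonempty
    have := P.minDegreeOn_le ∅ hu
    simp at this hF
    omega
  let w' : Fin n →₀ ℕ := Finsupp.equivFunOnFinite.symm fun i =>
    if i ∈ F then w i + (if j = i then P.minDegreeOn F - 1 - ∑ i ∈ F, w i else 0) else P.rank
  refine ⟨F, P.monomialPrimeIdeal_mem_associatedPrimes K (w := w') ?_ (fun G hG => ?_)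
    (fun i hi => ?_), hF⟩
  · have : ∑ i ∈ F, w' i =
        ∑ i ∈ F, (w i + if j = i then P.minDegreeOn F - 1 - ∑ i ∈ F, w i else 0) :=
      Finset.sum_congr rfl fun i hi => by simp [w', hi]
    rw [this, Finset.sum_add_distrib, Finset.sum_ite_eq, if_pos hj]
    omega
  · refine (not_lt.1 fun hlt => hmin G hlt hG).trans (Finset.sum_le_sum fun i hi => ?_)
    simp [w', hG.1 hi]
  · simp [w', hi]

lemma minDegreeOn_pos_of_mem_associatedPrimes {F : Finset (Fin n)}
    (hF : monomialPrimeIdeal K F ∈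
      associatedPrimes (MvPolynomial (Fin n) K) (MvPolynomial (Fin n) K ⧸ P.toIdeal K)) :
    0 < P.minDegreeOn F := by
  obtain ⟨u, hu, huF⟩ := P.exists_base_sum_eq_minDegreeOn F
  have hle : P.toIdeal K ≤ monomialPrimeIdeal K F := by
    have h := IsAssociatedPrime.annihilator_le hF
    rwa [Submodule.annihilator_top, Ideal.annihilator_quotient] at h
  have hmem : monomial u (1 : K) ∈ monomialPrimeIdeal K F :=
    hle (Ideal.subset_span ⟨u, hu, rfl⟩)
  obtain ⟨i, hi, hne⟩ := mem_monomialPrimeIdeal_iff.1 hmem u (by simp)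
  rw [← huF]
  exact lt_of_lt_of_le (Nat.pos_of_ne_zero hne)
    (Finset.single_le_sum (f := u) (fun _ _ => Nat.zero_le _) hi)

lemma toIdeal_eq_iInf : P.toIdeal K =
    ⨅ F ∈ {F : Finset (Fin n) | monomialPrimeIdeal K F ∈
      associatedPrimes (MvPolynomial (Fin n) K) (MvPolynomial (Fin n) K ⧸ P.toIdeal K)},
      monomialPrimeIdeal K F ^ P.minDegreeOn F := by
  refine le_antisymm (le_iInf₂ fun F _ => P.toIdeal_le_pow_minDegreeOn K F) fun f hf => ?_
  refine mem_ideal_span_monomial_image.2 fun a ha => ?_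
  by_contra! hcon
  obtain ⟨F, hF, hlt⟩ := P.exists_associatedPrime_sum_lt K hcon
  simp only [Submodule.mem_iInf] at hf
  exact absurd (le_sum_of_mem_monomialPrimeIdeal_pow (hf F hF) ha) (not_le.2 hlt)

lemma isIntersectionType_toIdeal : IsIntersectionType K (P.toIdeal K) := by
  classical
  let T : Finset (Finset (Fin n)) := Finset.univ.filter fun F => monomialPrimeIdeal K F ∈
    associatedPrimes (MvPolynomial (Fin n) K) (MvPolynomial (Fin n) K ⧸ P.toIdeal K)
  refine ⟨T.card, fun i => T.equivFin.symm i, fun i => P.minDegreeOn (T.equivFin.symm i).1,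
    fun i => P.minDegreeOn_pos_of_mem_associatedPrimes K
      (Finset.mem_filter.1 (T.equivFin.symm i).2).2, ?_⟩
  rw [T.equivFin.symm.iInf_congr (g := fun F : T =>
    monomialPrimeIdeal K F.1 ^ P.minDegreeOn F.1) fun _ => rfl, iInf_subtype]
  refine (P.toIdeal_eq_iInf K).trans ?_
  simp [T]

end DiscretePolymatroid

/-- Every polymatroidal ideal is of strong intersection type:
`I = ⋂_{p ∈ Ass(S/I)} p^{reg(I(p))}`. -/
theorem polymatroidal_strong_intersection_type {n : ℕ} (P : DiscretePolymatroid n)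
    (I : Ideal (MvPolynomial (Fin n) K)) (hI : I = P.toIdeal K) :
    IsIntersectionType K I ∧
      I = ⨅ F ∈ {F : Finset (Fin n) | monomialPrimeIdeal K F ∈
          associatedPrimes (MvPolynomial (Fin n) K) (MvPolynomial (Fin n) K ⧸ I)},
        (monomialPrimeIdeal K F) ^ (reg K (mLoc K I F)) := by
  subst hI
  simp only [P.reg_mLoc_toIdeal K]
  exact ⟨P.isIntersectionType_toIdeal K, P.toIdeal_eq_iInf K⟩

end
end

section
/- Let I be the edge ideal of a finite simple graph in S = K[x_1,...,x_n] and suppose I^2 is not of intersection type. Then for every k ≥ 2 the ideal I^k is not of intersection type. -/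
open MvPolynomial

noncomputable section

variable (K : Type) [Field K]

/-- The edge ideal of a finite simple graph. -/
def edgeIdeal {V : Type*} (G : SimpleGraph V) : Ideal (MvPolynomial V K) :=
  Ideal.span {f : MvPolynomial V K | ∃ i j : V, G.Adj i j ∧ f = X i * X j}

/-- `i, j, k` form a 3-cycle of `G`. -/
def IsThreeCycle {V : Type*} (G : SimpleGraph V) (i j k : V) : Prop :=
  G.Adj i j ∧ G.Adj j k ∧ G.Adj i k

/-- A 3-cycle of `G` is central if every vertex of `G` is a neighbor of one of its
vertices. -/
def IsCentralThreeCycle {V : Type*} (G : SimpleGraph V) (i j k : V) : Prop :=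
  IsThreeCycle G i j k ∧ ∀ v : V, G.Adj v i ∨ G.Adj v j ∨ G.Adj v k

open Finset in
/-- If `u` has weight at least two on every vertex cover of `G` and total weight at least four on
the non-isolated vertices, and every non-isolated vertex is adjacent to every triangle, then `u`
dominates the exponent of a product of two edges. -/
theorem SimpleGraph.exists_adj_adj_single_add_le {V : Type*} [Fintype V] [DecidableEq V]
    (G : SimpleGraph V) (u : V →₀ ℕ)
    (hcov : ∀ F : Finset V, (∀ a b, G.Adj a b → a ∈ F ∨ b ∈ F) → 2 ≤ ∑ i ∈ F, u i)
    (M : Finset V) (hM : ∀ v ∈ M, ∃ w, G.Adj v w) (h4 : 4 ≤ ∑ i ∈ M, u i)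
    (hG : ∀ a b c v w, IsThreeCycle G a b c → G.Adj v w →
      G.Adj v a ∨ G.Adj v b ∨ G.Adj v c) :
    ∃ a b c d, G.Adj a b ∧ G.Adj c d ∧
      Finsupp.single a 1 + Finsupp.single b 1 +
        (Finsupp.single c 1 + Finsupp.single d 1) ≤ u := by
  have key : ∀ a b c d : V,
      (∀ i, (if a = i then 1 else 0) + (if b = i then 1 else 0) +
        ((if c = i then 1 else 0) + (if d = i then 1 else 0)) ≤ u i) →
      Finsupp.single a 1 + Finsupp.single b 1 +
        (Finsupp.single c 1 + Finsupp.single d 1) ≤ u := by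
    intro a b c d h i
    simpa [Finsupp.single_apply] using h i
  have sum_le_of : ∀ (F : Finset V) (x : V), ∑ i ∈ F, (if x = i then 1 else 0) ≤ 1 := by
    intro F x
    rw [Finset.sum_ite_eq]
    split_ifs
    exacts [le_rfl, zero_le_one]
  obtain ⟨a, b, hab, ha, hb⟩ : ∃ a b, G.Adj a b ∧ 1 ≤ u a ∧ 1 ≤ u b := by
    by_contra! hno
    have h := hcov (univ.filter fun i => u i = 0) (by
      intro a b hab
      have := hno a b hab
      simp only [mem_filter, mem_univ, true_and]
      omega)
    rw [Finset.sum_eq_zero (by simp)] at h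
    omega
  have hne := hab.ne
  by_cases hW : ∃ c d, G.Adj c d ∧
      (if a = c then 1 else 0) + (if b = c then 1 else 0) < u c ∧
      (if a = d then 1 else 0) + (if b = d then 1 else 0) < u d
  · obtain ⟨c, d, hcd, hc, hd⟩ := hW
    have hne' := hcd.ne
    refine ⟨a, b, c, d, hab, hcd, key _ _ _ _ fun i => ?_⟩
    grind
  push Not at hW
  set F : Finset V := univ.filter fun i =>
    u i ≤ (if a = i then 1 else 0) + (if b = i then 1 else 0) with hF
  have memF : ∀ i, i ∈ F ↔ u i ≤ (if a = i then 1 else 0) + (if b = i then 1 else 0) := by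
    simp [hF]
  have hFcov : ∀ c d, G.Adj c d → c ∈ F ∨ d ∈ F := by
    intro c d hcd
    have := hW c d hcd
    rw [memF, memF]
    omega
  have hFsum := hcov F hFcov
  have hFle : ∑ i ∈ F, u i ≤ (if a ∈ F then 1 else 0) + (if b ∈ F then 1 else 0) := by
    refine (Finset.sum_le_sum fun i hi => (memF i).1 hi).trans ?_
    rw [Finset.sum_add_distrib, Finset.sum_ite_eq, Finset.sum_ite_eq]
  have haF : a ∈ F := by
    by_contra h
    rw [if_neg h] at hFle
    split_ifs at hFle <;> omega
  have hbF : b ∈ F := by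
    by_contra h
    rw [if_neg h] at hFle
    split_ifs at hFle <;> omega
  have hua : u a = 1 := by
    have := (memF a).1 haF
    grind
  have hub : u b = 1 := by
    have := (memF b).1 hbF
    grind
  have hnbr : ∀ x ∈ F, u x = 1 → ∃ c, c ∉ F ∧ G.Adj x c := by
    intro x hx hux
    have hlt : ¬ 2 ≤ ∑ i ∈ F.erase x, u i := by
      have := Finset.add_sum_erase F u hx
      rw [if_pos haF, if_pos hbF] at hFle
      omega
    have hnc := mt (hcov (F.erase x)) hlt
    push Not at hnc
    obtain ⟨c, d, hcd, hc, hd⟩ := hnc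
    have hcd' := hFcov c d hcd
    simp only [mem_erase, not_and] at hc hd
    by_cases hcx : c = x
    · subst hcx
      exact ⟨d, hd hcd.ne', hcd⟩
    · have hdx : d = x := by
        by_contra h
        exact hcd'.elim (hc hcx) (hd h)
      subst hdx
      exact ⟨c, hc hcx, hcd.symm⟩
  obtain ⟨c, hcF, hac⟩ := hnbr a haF hua
  obtain ⟨d, hdF, hbd⟩ := hnbr b hbF hub
  have hca : a ≠ c := hac.ne
  have hcb : b ≠ c := fun h => hcF (h ▸ hbF)
  have hdb : b ≠ d := hbd.ne
  have hda : a ≠ d := fun h => hdF (h ▸ haF)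
  have huc : 1 ≤ u c := by
    rw [memF] at hcF
    omega
  have hud : 1 ≤ u d := by
    rw [memF] at hdF
    omega
  by_cases hcd : c = d
  swap
  · refine ⟨a, c, b, d, hac, hbd, key _ _ _ _ fun i => ?_⟩
    grind
  subst hcd
  by_cases huc2 : 2 ≤ u c
  · refine ⟨a, c, b, c, hac, hbd, key _ _ _ _ fun i => ?_⟩
    grind
  obtain ⟨v, hvM, hva, hvb, hvc, huv⟩ :
      ∃ v ∈ M, a ≠ v ∧ b ≠ v ∧ c ≠ v ∧ 1 ≤ u v := by
    by_contra! hno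
    have : ∑ i ∈ M, u i ≤ ∑ i ∈ M, ((if a = i then 1 else 0) + (if b = i then 1 else 0) +
        (if c = i then 1 else 0)) := by
      refine Finset.sum_le_sum fun i hi => ?_
      have := hno i hi
      grind
    rw [Finset.sum_add_distrib, Finset.sum_add_distrib] at this
    have h1 := sum_le_of M a
    have h2 := sum_le_of M b
    have h3 := sum_le_of M c
    omega
  obtain ⟨w, hvw⟩ := hM v hvM
  rcases hG a b c v w ⟨hab, hbd, hac⟩ hvw with h | h | h
  · refine ⟨v, a, b, c, h, hbd, key _ _ _ _ fun i => ?_⟩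
    grind
  · refine ⟨v, b, a, c, h, hac, key _ _ _ _ fun i => ?_⟩
    grind
  · refine ⟨v, c, a, b, h, hab, key _ _ _ _ fun i => ?_⟩
    grind

/-- The ideal generated by the monomials whose weight with respect to `w` is at least `d`. -/
def weightIdeal {σ : Type*} (w : σ → ℕ) (d : ℕ) : Ideal (MvPolynomial σ K) :=
  Ideal.span ((fun u => monomial u (1 : K)) '' {u | d ≤ Finsupp.weight w u})

theorem mem_weightIdeal {σ : Type*} {w : σ → ℕ} {d : ℕ} {f : MvPolynomial σ K} :
    f ∈ weightIdeal K w d ↔ ∀ u ∈ f.support, d ≤ Finsupp.weight w u := by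
  rw [weightIdeal, mem_ideal_span_monomial_image]
  refine forall₂_congr fun u _ => ⟨?_, fun h => ⟨u, h, le_rfl⟩⟩
  rintro ⟨s, hs, hsu⟩
  obtain ⟨t, rfl⟩ := exists_add_of_le hsu
  rw [map_add]
  exact le_add_right hs

theorem monomial_mem_weightIdeal {σ : Type*} {w : σ → ℕ} {d : ℕ} {u : σ →₀ ℕ} :
    monomial u (1 : K) ∈ weightIdeal K w d ↔ d ≤ Finsupp.weight w u := by
  classical
  rw [mem_weightIdeal, support_monomial, if_neg one_ne_zero]
  simp

theorem weightIdeal_mul_le {σ : Type*} (w : σ → ℕ) (d e : ℕ) :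
    weightIdeal K w d * weightIdeal K w e ≤ weightIdeal K w (d + e) := by
  rw [weightIdeal, weightIdeal, Ideal.span_mul_span', Ideal.span_le]
  rintro _ ⟨_, ⟨u, hu, rfl⟩, _, ⟨v, hv, rfl⟩, rfl⟩
  simp only [monomial_mul, mul_one, SetLike.mem_coe, monomial_mem_weightIdeal, map_add]
  exact add_le_add hu hv

theorem pow_le_weightIdeal {σ : Type*} {w : σ → ℕ} {d : ℕ} {J : Ideal (MvPolynomial σ K)}
    (hJ : J ≤ weightIdeal K w d) (k : ℕ) : J ^ k ≤ weightIdeal K w (k * d) := by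
  induction k with
  | zero =>
    intro f _
    simp [mem_weightIdeal]
  | succ k ih =>
    rw [pow_succ, Nat.succ_mul]
    exact (Ideal.mul_mono ih hJ).trans (weightIdeal_mul_le K w _ _)

theorem weight_indicator {n : ℕ} (F : Finset (Fin n)) (u : Fin n →₀ ℕ) :
    Finsupp.weight (fun i => if i ∈ F then 1 else 0) u = ∑ i ∈ F, u i := by
  rw [Finsupp.weight_apply, Finsupp.sum_fintype _ _ (by simp)]
  simp

theorem monomialPrimeIdeal_pow {n : ℕ} (F : Finset (Fin n)) (d : ℕ) :
    monomialPrimeIdeal K F ^ d = weightIdeal K (fun i => if i ∈ F then 1 else 0) d := by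
  apply le_antisymm
  · have h : monomialPrimeIdeal K F ≤ weightIdeal K (fun i => if i ∈ F then 1 else 0) 1 := by
      rw [monomialPrimeIdeal, Ideal.span_le]
      rintro _ ⟨i, hi, rfl⟩
      have hi' : i ∈ F := hi
      change monomial (Finsupp.single i 1) (1 : K) ∈ weightIdeal K _ 1
      rw [monomial_mem_weightIdeal]
      simp [Finsupp.weight_single, hi']
    simpa using pow_le_weightIdeal K h d
  · rw [weightIdeal, Ideal.span_le]
    rintro _ ⟨u, hu, rfl⟩
    rw [Set.mem_ofPred_eq, weight_indicator] at hu
    change monomial u (1 : K) ∈ monomialPrimeIdeal K F ^ d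
    induction d generalizing u with
    | zero => simp
    | succ d ih =>
      obtain ⟨i, hi, hui⟩ : ∃ i ∈ F, u i ≠ 0 :=
        Finset.exists_ne_zero_of_sum_ne_zero (by omega : ∑ i ∈ F, u i ≠ 0)
      have hle : Finsupp.single i 1 ≤ u := by
        rw [Finsupp.single_le_iff]
        omega
      obtain ⟨v, rfl⟩ := exists_add_of_le hle
      have hv : d ≤ ∑ j ∈ F, v j := by
        have : ∑ j ∈ F, (Finsupp.single i 1 : Fin n →₀ ℕ) j = 1 := by
          simp [Finsupp.single_apply, hi]
        simp only [Finsupp.add_apply, Finset.sum_add_distrib] at hu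
        omega
      have hmul : monomial (Finsupp.single i 1 + v) (1 : K) = monomial v 1 * X i := by
        rw [X, monomial_mul, mul_one, add_comm]
      rw [hmul, pow_succ]
      exact Ideal.mul_mem_mul (ih v hv) (Ideal.subset_span ⟨i, hi, rfl⟩)

theorem X_mul_X_mem_edgeIdeal {V : Type*} {G : SimpleGraph V} {a b : V} (h : G.Adj a b) :
    (X a * X b : MvPolynomial V K) ∈ edgeIdeal K G :=
  Ideal.subset_span ⟨a, b, h, rfl⟩

theorem X_mul_X_eq_monomial {V : Type*} (a b : V) :
    (X a * X b : MvPolynomial V K) =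
      monomial (Finsupp.single a 1 + Finsupp.single b 1) 1 := by
  rw [X, X, monomial_mul, mul_one]

theorem edgeIdeal_le_weightIdeal {V : Type*} {G : SimpleGraph V} {w : V → ℕ} {d : ℕ}
    (h : ∀ a b, G.Adj a b → d ≤ w a + w b) : edgeIdeal K G ≤ weightIdeal K w d := by
  rw [edgeIdeal, Ideal.span_le]
  rintro _ ⟨a, b, hab, rfl⟩
  rw [X_mul_X_eq_monomial, SetLike.mem_coe, monomial_mem_weightIdeal]
  simpa [Finsupp.weight_single] using h a b hab

theorem isIntersectionType_of_finite {n : ℕ} {ι : Type*} [Finite ι]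
    {I : Ideal (MvPolynomial (Fin n) K)} (F : ι → Finset (Fin n)) (d : ι → ℕ)
    (hd : ∀ i, 0 < d i) (hI : I = ⨅ i, monomialPrimeIdeal K (F i) ^ d i) :
    IsIntersectionType K I := by
  obtain ⟨r, ⟨e⟩⟩ := Finite.exists_equiv_fin ι
  refine ⟨r, F ∘ e.symm, d ∘ e.symm, fun i => hd _, ?_⟩
  rw [hI]
  exact (Equiv.iInf_comp (g := fun i => monomialPrimeIdeal K (F i) ^ d i) e.symm).symm

/-- If every non-isolated vertex is adjacent to every triangle, then the square of the edge ideal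
is of intersection type. -/
theorem isIntersectionType_edgeIdeal_sq {n : ℕ} (G : SimpleGraph (Fin n))
    (hG : ∀ a b c v w, IsThreeCycle G a b c → G.Adj v w →
      G.Adj v a ∨ G.Adj v b ∨ G.Adj v c) :
    IsIntersectionType K (edgeIdeal K G ^ 2) := by
  classical
  let M : Finset (Fin n) := Finset.univ.filter fun v => ∃ w, G.Adj v w
  have memM : ∀ v, v ∈ M ↔ ∃ w, G.Adj v w := by simp [M]
  let F : Option {F : Finset (Fin n) // ∀ a b, G.Adj a b → a ∈ F ∨ b ∈ F} → Finset (Fin n) :=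
    fun o => o.elim M Subtype.val
  let d : Option {F : Finset (Fin n) // ∀ a b, G.Adj a b → a ∈ F ∨ b ∈ F} → ℕ :=
    fun o => o.elim 4 fun _ => 2
  refine isIntersectionType_of_finite K F d ?_ (le_antisymm (le_iInf ?_) ?_)
  · rintro (_ | _) <;> simp [d]
  · rintro (_ | ⟨C, hC⟩)
    · simp only [F, d, Option.elim_none, monomialPrimeIdeal_pow]
      refine pow_le_weightIdeal K (d := 2) (edgeIdeal_le_weightIdeal K fun a b hab => ?_) 2
      rw [if_pos ((memM a).2 ⟨b, hab⟩), if_pos ((memM b).2 ⟨a, hab.symm⟩)]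
    · simp only [F, d, Option.elim_some, monomialPrimeIdeal_pow]
      refine pow_le_weightIdeal K (d := 1) (edgeIdeal_le_weightIdeal K fun a b hab => ?_) 2
      rcases hC a b hab with h | h <;> simp [h]
  · intro f hf
    rw [Ideal.mem_iInf] at hf
    rw [f.as_sum]
    refine Ideal.sum_mem _ fun u hu => ?_
    have hf' : ∀ o, d o ≤ ∑ i ∈ F o, u i := fun o => by
      have := hf o
      rw [monomialPrimeIdeal_pow, mem_weightIdeal] at this
      simpa only [weight_indicator] using this u hu
    obtain ⟨a, b, c, e, hab, hce, hle⟩ := G.exists_adj_adj_single_add_le u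
      (fun C hC => hf' (some ⟨C, hC⟩)) M (fun v hv => (memM v).1 hv) (hf' none) hG
    obtain ⟨t, rfl⟩ := exists_add_of_le hle
    have hmul : monomial (Finsupp.single a 1 + Finsupp.single b 1 +
          (Finsupp.single c 1 + Finsupp.single e 1) + t) (coeff (Finsupp.single a 1 +
          Finsupp.single b 1 + (Finsupp.single c 1 + Finsupp.single e 1) + t) f) =
        (X a * X b) * (X c * X e) * monomial t (coeff (Finsupp.single a 1 +
          Finsupp.single b 1 + (Finsupp.single c 1 + Finsupp.single e 1) + t) f) := by
      rw [X_mul_X_eq_monomial, X_mul_X_eq_monomial, monomial_mul, monomial_mul]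
      simp
    rw [hmul, sq]
    exact Ideal.mul_mem_right _ _
      (Ideal.mul_mem_mul (X_mul_X_mem_edgeIdeal K hab) (X_mul_X_mem_edgeIdeal K hce))

/-- If some non-isolated vertex is not adjacent to some triangle, then no power `I ^ k`, `k ≥ 2`,
of the edge ideal is of intersection type. -/
theorem not_isIntersectionType_edgeIdeal_pow {n : ℕ} (G : SimpleGraph (Fin n))
    {a b c v w : Fin n} (hT : IsThreeCycle G a b c) (hvw : G.Adj v w)
    (hva : ¬ G.Adj v a) (hvb : ¬ G.Adj v b) (hvc : ¬ G.Adj v c) {k : ℕ} (hk : 2 ≤ k) :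
    ¬ IsIntersectionType K (edgeIdeal K G ^ k) := by
  rintro ⟨r, F, d, hd, hI⟩
  obtain ⟨hab, hbc, hac⟩ := hT
  obtain ⟨m, rfl⟩ := Nat.exists_eq_add_of_le' hk
  let u : Fin n →₀ ℕ := Finsupp.single a (m + 1) + Finsupp.single b (m + 1) +
    Finsupp.single c 1 + Finsupp.single v 1
  have hu : ∀ wt : Fin n → ℕ,
      Finsupp.weight wt u = (m + 1) * wt a + (m + 1) * wt b + wt c + wt v := by
    intro wt
    simp only [u, map_add, Finsupp.weight_single, smul_eq_mul, one_mul]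
  have hmem : monomial u (1 : K) ∈ edgeIdeal K G ^ (m + 2) := by
    rw [hI, Ideal.mem_iInf]
    intro i
    have hedge : ∀ x y, G.Adj x y →
        d i ≤ (m + 2) * ((if x ∈ F i then 1 else 0) + (if y ∈ F i then 1 else 0)) := by
      intro x y hxy
      have hle : edgeIdeal K G ^ (m + 2) ≤ monomialPrimeIdeal K (F i) ^ d i :=
        hI.trans_le (iInf_le _ i)
      have := hle (Ideal.pow_mem_pow (X_mul_X_mem_edgeIdeal K hxy) (m + 2))
      rw [X_mul_X_eq_monomial, monomial_pow, one_pow, monomialPrimeIdeal_pow,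
        monomial_mem_weightIdeal, map_nsmul, map_add] at this
      simpa [Finsupp.weight_single] using this
    rw [monomialPrimeIdeal_pow, monomial_mem_weightIdeal, hu]
    have h0 := hd i
    have h1 := hedge a b hab
    have h2 := hedge b c hbc
    have h3 := hedge a c hac
    have h4 := hedge v w hvw
    split_ifs at * <;> omega
  -- This weight is at least two on every edge, but `u` has weight `2 * (m + 2) - 1`.
  let wt : Fin n → ℕ := fun x => if x = v then 0 else if x = a ∨ x = b ∨ x = c then 1 else 2
  have hwt : edgeIdeal K G ≤ weightIdeal K wt 2 := by
    refine edgeIdeal_le_weightIdeal K fun x y hxy => ?_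
    have hne := hxy.ne
    have hyx := hxy.symm
    simp only [wt]
    grind
  have h := pow_le_weightIdeal K hwt (m + 2) hmem
  have hav : a ≠ v := fun h => hvb (h ▸ hab)
  have hbv : b ≠ v := fun h => hvc (h ▸ hbc)
  have hcv : c ≠ v := fun h => hva (h ▸ hac.symm)
  rw [monomial_mem_weightIdeal, hu] at h
  simp [wt, hav, hbv, hcv] at h
  omega

/-- If the square of an edge ideal is not of intersection type, then
no higher power `I^k`, `k ≥ 2`, is of intersection type. -/
theorem powers_edge_ideal_not_intersection_type {n : ℕ} (G : SimpleGraph (Fin n))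
    (I : Ideal (MvPolynomial (Fin n) K)) (hI : I = edgeIdeal K G)
    (h2 : ¬ IsIntersectionType K (I ^ 2)) :
    ∀ k : ℕ, 2 ≤ k → ¬ IsIntersectionType K (I ^ k) := by
  subst hI
  intro k hk
  have hG := mt (isIntersectionType_edgeIdeal_sq K G) h2
  push Not at hG
  obtain ⟨a, b, c, v, w, hT, hvw, hva, hvb, hvc⟩ := hG
  exact not_isIntersectionType_edgeIdeal_pow K G hT hvw hva hvb hvc hk

end
end

section
/- Every monomial ideal of intersection type is integrally closed: if I ⊂ S = K[x_1,...,x_n] is an intersection of powers of monomial prime ideals, then I equals its integral closure. -/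
open MvPolynomial

noncomputable section

variable (K : Type) [Field K]

/-- `x` is integral over the ideal `I`: it satisfies an equation
`x^n + c_1 x^{n-1} + ⋯ + c_n = 0` with `c_i ∈ I^i`. -/
def IsIntegralOverIdeal {R : Type*} [CommRing R] (I : Ideal R) (x : R) : Prop :=
  ∃ n : ℕ, 0 < n ∧ ∃ c : ℕ → R, (∀ i, 1 ≤ i → i ≤ n → c i ∈ I ^ i) ∧
    x ^ n + ∑ i ∈ Finset.Icc 1 n, c i * x ^ (n - i) = 0

/-- An ideal is integrally closed if it contains every element integral over it. -/
def IsIntegrallyClosedIdeal {R : Type*} [CommRing R] (I : Ideal R) : Prop :=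
  ∀ x : R, IsIntegralOverIdeal I x → x ∈ I

variable {K}

/-- The order of `f` along `p_F`: the least degree in the variables `x_i`, `i ∈ F`, of a
monomial of `f`, with value `⊤` at `0`. -/
def orderAlong {n : ℕ} (F : Finset (Fin n)) (f : MvPolynomial (Fin n) K) : ℕ∞ :=
  (f : MvPowerSeries (Fin n) K).weightedOrder (fun i => if i ∈ F then 1 else 0)

section orderAlong

variable {n : ℕ} (F : Finset (Fin n))

lemma orderAlong_zero : orderAlong F (0 : MvPolynomial (Fin n) K) = ⊤ := by
  simp [orderAlong]

lemma orderAlong_one : orderAlong F (1 : MvPolynomial (Fin n) K) = 0 := by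
  simp [orderAlong]

lemma orderAlong_mul (f g : MvPolynomial (Fin n) K) :
    orderAlong F (f * g) = orderAlong F f + orderAlong F g := by
  simp [orderAlong, MvPowerSeries.weightedOrder_mul]

lemma orderAlong_pow (f : MvPolynomial (Fin n) K) (k : ℕ) :
    orderAlong F (f ^ k) = k * orderAlong F f := by
  induction k with
  | zero => simp [orderAlong_one]
  | succ k ih => rw [pow_succ, orderAlong_mul, ih]; push_cast; ring

lemma orderAlong_neg (f : MvPolynomial (Fin n) K) : orderAlong F (-f) = orderAlong F f := by
  have h : orderAlong F (-1 : MvPolynomial (Fin n) K) = 0 := by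
    have h' := orderAlong_mul F (-1 : MvPolynomial (Fin n) K) (-1)
    rw [neg_mul_neg, one_mul, orderAlong_one] at h'
    exact (add_eq_zero.mp h'.symm).1
  rw [← neg_one_mul, orderAlong_mul, h, zero_add]

lemma le_orderAlong_add {k : ℕ∞} {f g : MvPolynomial (Fin n) K} (hf : k ≤ orderAlong F f)
    (hg : k ≤ orderAlong F g) : k ≤ orderAlong F (f + g) := by
  unfold orderAlong at *
  rw [MvPolynomial.coe_add]
  exact (le_min hf hg).trans (MvPowerSeries.min_weightedOrder_le_add _)

lemma le_orderAlong_of_mem_pow {k : ℕ} {f : MvPolynomial (Fin n) K}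
    (hf : f ∈ monomialPrimeIdeal K F ^ k) : (k : ℕ∞) ≤ orderAlong F f := by
  induction k generalizing f with
  | zero => simp
  | succ k ih =>
    rw [pow_succ] at hf
    refine Submodule.mul_induction_on hf (fun g hg h hh => ?_)
      (fun g h hg hh => le_orderAlong_add F hg hh)
    rw [orderAlong_mul]
    push_cast
    refine add_le_add (ih hg) ?_
    refine Submodule.span_induction ?_ ?_ (fun a b _ _ ha hb => le_orderAlong_add F ha hb) ?_ hh
    · rintro _ ⟨i, hi, rfl⟩
      have hi' : i ∈ F := hi
      simp [orderAlong, MvPowerSeries.X, MvPowerSeries.weightedOrder_monomial_of_ne_zero,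
        Finsupp.weight_apply, hi']
    · simp [orderAlong_zero]
    · intro a b _ hb
      rw [smul_eq_mul, orderAlong_mul]
      exact hb.trans le_add_self

lemma mem_pow_of_le_orderAlong {k : ℕ} {f : MvPolynomial (Fin n) K}
    (hf : (k : ℕ∞) ≤ orderAlong F f) : f ∈ monomialPrimeIdeal K F ^ k := by
  rw [← support_sum_monomial_coeff f]
  refine Ideal.sum_mem _ fun m hm => ?_
  have hkm : k ≤ ∑ i ∈ F, m i := by
    have h := hf.trans (MvPowerSeries.weightedOrder_le (d := m) _
      (by simpa [MvPolynomial.coeff_coe] using hm))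
    simp only [Finsupp.weight_apply, smul_eq_mul, mul_ite, mul_one, mul_zero,
      ite_self, implies_true, Finsupp.sum_fintype, Finset.sum_ite_mem, Finset.univ_inter] at h
    exact_mod_cast h
  rw [monomial_eq, Finsupp.prod_fintype _ _ (by simp),
    ← Finset.prod_mul_prod_compl F, ← mul_assoc]
  refine Ideal.mul_mem_right _ _ (Ideal.mul_mem_left _ _ (Ideal.pow_le_pow_right hkm ?_))
  rw [← Finset.prod_pow_eq_pow_sum]
  exact Ideal.prod_mem_prod fun i hi =>
    Ideal.pow_mem_pow (Ideal.subset_span (Set.mem_image_of_mem _ hi)) _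

lemma mem_monomialPrimeIdeal_pow_iff {k : ℕ} {f : MvPolynomial (Fin n) K} :
    f ∈ monomialPrimeIdeal K F ^ k ↔ (k : ℕ∞) ≤ orderAlong F f :=
  ⟨le_orderAlong_of_mem_pow F, mem_pow_of_le_orderAlong F⟩

lemma isIntegrallyClosedIdeal_monomialPrimeIdeal_pow (d : ℕ) :
    IsIntegrallyClosedIdeal (monomialPrimeIdeal K F ^ d) := by
  rintro x ⟨N, -, c, hc, hx⟩
  rw [mem_monomialPrimeIdeal_pow_iff]
  by_contra! hlt
  obtain ⟨m, hm⟩ := ENat.ne_top_iff_exists.mp (ne_top_of_lt hlt)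
  rw [← hm, Nat.cast_lt] at hlt
  have hsum : ((N * m + 1 : ℕ) : ℕ∞) ≤
      orderAlong F (∑ i ∈ Finset.Icc 1 N, c i * x ^ (N - i)) := by
    refine Finset.sum_induction _ (fun f => ((N * m + 1 : ℕ) : ℕ∞) ≤ orderAlong F f)
      (fun _ _ => le_orderAlong_add F) (by simp [orderAlong_zero]) fun i hi => ?_
    obtain ⟨hi, hiN⟩ := Finset.mem_Icc.mp hi
    have hci := hc i hi hiN
    rw [← pow_mul, mem_monomialPrimeIdeal_pow_iff] at hci
    rw [orderAlong_mul, orderAlong_pow, ← hm]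
    refine le_trans ?_ (add_le_add_left hci _)
    norm_cast
    obtain ⟨j, rfl⟩ := Nat.exists_eq_add_of_le hiN
    rw [Nat.add_sub_cancel_left]
    nlinarith
  rw [eq_neg_of_add_eq_zero_right hx, orderAlong_neg, orderAlong_pow, ← hm] at hsum
  norm_cast at hsum
  omega

end orderAlong

lemma IsIntegralOverIdeal.mono {R : Type*} [CommRing R] {I J : Ideal R} (hIJ : I ≤ J) {x : R}
    (hx : IsIntegralOverIdeal I x) : IsIntegralOverIdeal J x := by
  obtain ⟨N, hN, c, hc, h⟩ := hx
  exact ⟨N, hN, c, fun i hi hiN => Ideal.pow_right_mono hIJ i (hc i hi hiN), h⟩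

lemma IsIntegrallyClosedIdeal.iInf {R : Type*} [CommRing R] {ι : Sort*} {J : ι → Ideal R}
    (hJ : ∀ i, IsIntegrallyClosedIdeal (J i)) : IsIntegrallyClosedIdeal (⨅ i, J i) :=
  fun _ hx => (Submodule.mem_iInf _).mpr fun i => hJ i _ (hx.mono (iInf_le J i))

variable (K)

/-- Every monomial ideal of intersection type (an intersection of
powers of monomial prime ideals) is integrally closed. -/
theorem intersectionType_integrally_closed {n : ℕ}
    (I : Ideal (MvPolynomial (Fin n) K)) (hI : IsIntersectionType K I) :
    IsIntegrallyClosedIdeal I := by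
  obtain ⟨r, F, d, -, rfl⟩ := hI
  exact .iInf fun i => isIntegrallyClosedIdeal_monomialPrimeIdeal_pow (F i) (d i)

end
end
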